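/- Let A > 0 and set f(x) = A x^{−(3+λ)/2} for x > 0. For R > 0 define D₁⁻(R) = {(y,z) : 0 < y ≤ R, 0 < z ≤ R, y + z ≥ R} and D₂⁻(R) = {(y,z) : 0 < y ≤ R, z ≥ R}, and the outgoing particle flux J_R⁻ = (1/2) ∬_{D₁⁻(R)} f(y) f(z) (yz)^{λ/2} (y + z) dy dz + ∬_{D₂⁻(R)} f(y) f(z) (yz)^{λ/2} y dy dz. Then for every R > 0 both double integrals converge absolutely and J_R⁻ = 2π A²; in particular lim_{R→∞} J_R⁻ = 2π A². -/

import Mathlib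

open MeasureTheory Real Set Filter

/-- The region `D₁⁻(R)`. -/
def D1minus (R : ℝ) : Set (ℝ × ℝ) :=
  {p : ℝ × ℝ | 0 < p.1 ∧ p.1 ≤ R ∧ 0 < p.2 ∧ p.2 ≤ R ∧ R ≤ p.1 + p.2}

/-- The region `D₂⁻(R)`. -/
def D2minus (R : ℝ) : Set (ℝ × ℝ) :=
  {p : ℝ × ℝ | 0 < p.1 ∧ p.1 ≤ R ∧ R ≤ p.2}

/-- The outgoing particle flux `J_R⁻` for the profile `f(x) = A x^{-(3+λ)/2}`. -/
noncomputable def Jflux (lam A R : ℝ) : ℝ :=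
  (1/2) * (∫ p in D1minus R,
      (A * p.1 ^ (-(3 + lam)/2)) * (A * p.2 ^ (-(3 + lam)/2))
        * (p.1 * p.2) ^ (lam/2) * (p.1 + p.2))
  + ∫ p in D2minus R,
      (A * p.1 ^ (-(3 + lam)/2)) * (A * p.2 ^ (-(3 + lam)/2))
        * (p.1 * p.2) ^ (lam/2) * p.1

/-- The density `y^{-1/2} z^{-3/2}`. -/
noncomputable def fluxDensity (p : ℝ × ℝ) : ℝ := p.1 ^ (-(1/2) : ℝ) * p.2 ^ (-(3/2) : ℝ)

/-- The pairs with `0 < y < R` and `R ≤ y + z`. -/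
def crossingRegion (R : ℝ) : Set (ℝ × ℝ) :=
  {p : ℝ × ℝ | 0 < p.1 ∧ p.1 < R ∧ R ≤ p.1 + p.2}

lemma measurable_fluxDensity : Measurable fluxDensity := by
  unfold fluxDensity
  fun_prop

lemma measurableSet_crossingRegion (R : ℝ) : MeasurableSet (crossingRegion R) :=
  (measurableSet_lt measurable_const measurable_fst).inter
    ((measurableSet_lt measurable_fst measurable_const).inter
      (measurableSet_le measurable_const (measurable_fst.add measurable_snd)))

lemma hasDerivAt_arcsin_affine {R y : ℝ} (hy : y ∈ Ioo 0 R) :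
    HasDerivAt (fun y => arcsin (2 * y / R - 1))
      (y ^ (-(1/2) : ℝ) * (R - y) ^ (-(1/2) : ℝ)) y := by
  obtain ⟨h0, h1⟩ := hy
  have hR : 0 < R := h0.trans h1
  have hq : 0 < y / R := by positivity
  have hq1 : y / R < 1 := (div_lt_one hR).2 h1
  have hd : HasDerivAt (fun y : ℝ => 2 * y / R - 1) (2 / R) y := by
    simpa using (((hasDerivAt_id y).const_mul 2).div_const R).sub_const 1
  have h := (hasDerivAt_arcsin (x := 2 * y / R - 1)
    (by rw [mul_div_assoc]; intro h; linarith)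
    (by rw [mul_div_assoc]; intro h; linarith)).comp y hd
  refine h.congr_deriv ?_
  have e : 1 - (2 * y / R - 1) ^ 2 = (2 / R) ^ 2 * (y * (R - y)) := by
    field_simp
    ring
  rw [e, sqrt_mul (by positivity), sqrt_sq (by positivity), ← mul_rpow h0.le (by linarith),
    rpow_neg (mul_nonneg h0.le (by linarith)), ← sqrt_eq_rpow]
  have : 0 < √(y * (R - y)) := sqrt_pos.2 (mul_pos h0 (by linarith))
  field_simp

lemma integrableOn_arcsine_density (R : ℝ) :
    IntegrableOn (fun y : ℝ => y ^ (-(1/2) : ℝ) * (R - y) ^ (-(1/2) : ℝ)) (Ioc 0 R) :=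
  intervalIntegral.integrableOn_deriv_of_nonneg (g := fun y => arcsin (2 * y / R - 1))
    (by fun_prop) (fun _ hy => hasDerivAt_arcsin_affine hy)
    fun _ hy => mul_nonneg (rpow_nonneg hy.1.le _) (rpow_nonneg (by linarith [hy.2]) _)

lemma integral_arcsine_density {R : ℝ} (hR : 0 < R) :
    ∫ y in Ioo 0 R, y ^ (-(1/2) : ℝ) * (R - y) ^ (-(1/2) : ℝ) = π := by
  rw [← integral_Ioc_eq_integral_Ioo, ← intervalIntegral.integral_of_le hR.le,
    intervalIntegral.integral_eq_sub_of_hasDerivAt_of_le hR.le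
      (f := fun y => arcsin (2 * y / R - 1)) (by fun_prop)
      (fun _ hy => hasDerivAt_arcsin_affine hy)
      ((intervalIntegrable_iff_integrableOn_Ioc_of_le hR.le).2 (integrableOn_arcsine_density R))]
  have e : 2 * R / R - 1 = 1 := by field_simp; norm_num
  simp [e]

lemma crossingRegion_slice {R y : ℝ} (hy : y ∈ Ioo 0 R) :
    (fun z => (crossingRegion R).indicator fluxDensity (y, z))
      = (Ici (R - y)).indicator fun z => y ^ (-(1/2) : ℝ) * z ^ (-(3/2) : ℝ) := by
  ext z
  have : (y, z) ∈ crossingRegion R ↔ z ∈ Ici (R - y) := by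
    simp only [crossingRegion, mem_ofPred_eq, mem_Ici, hy.1, hy.2, true_and]
    constructor <;> intro h <;> linarith
  by_cases hz : z ∈ Ici (R - y)
  · rw [indicator_of_mem hz, indicator_of_mem (this.2 hz), fluxDensity]
  · rw [indicator_of_notMem hz, indicator_of_notMem (mt this.1 hz)]

lemma crossingRegion_slice_eq_zero {R y : ℝ} (hy : y ∉ Ioo 0 R) :
    (fun z => (crossingRegion R).indicator fluxDensity (y, z)) = 0 := by
  ext z
  exact indicator_of_notMem (fun h => hy ⟨h.1, h.2.1⟩) _

lemma integrable_crossingRegion_slice (R y : ℝ) :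
    Integrable fun z => (crossingRegion R).indicator fluxDensity (y, z) := by
  by_cases hy : y ∈ Ioo 0 R
  · rw [crossingRegion_slice hy, integrable_indicator_iff measurableSet_Ici,
      integrableOn_Ici_iff_integrableOn_Ioi]
    exact (integrableOn_Ioi_rpow_of_lt (by norm_num) (by linarith [hy.2])).const_mul _
  · rw [crossingRegion_slice_eq_zero hy]
    exact integrable_zero _ _ _

lemma integral_crossingRegion_slice (R : ℝ) :
    (fun y => ∫ z, (crossingRegion R).indicator fluxDensity (y, z))
      = (Ioo 0 R).indicator fun y => 2 * (y ^ (-(1/2) : ℝ) * (R - y) ^ (-(1/2) : ℝ)) := by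
  ext y
  by_cases hy : y ∈ Ioo 0 R
  · rw [indicator_of_mem hy, crossingRegion_slice hy, integral_indicator measurableSet_Ici,
      integral_Ici_eq_integral_Ioi, integral_const_mul,
      integral_Ioi_rpow_of_lt (by norm_num) (by linarith [hy.2])]
    norm_num
    ring
  · rw [indicator_of_notMem hy, crossingRegion_slice_eq_zero hy]
    simp

lemma fluxDensity_indicator_nonneg (R : ℝ) (p : ℝ × ℝ) :
    0 ≤ (crossingRegion R).indicator fluxDensity p :=
  indicator_nonneg (fun q hq => mul_nonneg (rpow_nonneg hq.1.le _)
    (rpow_nonneg (by linarith [hq.2.1, hq.2.2]) _)) p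

lemma integrable_crossingRegion (R : ℝ) :
    Integrable ((crossingRegion R).indicator fluxDensity) := by
  have hm : AEStronglyMeasurable ((crossingRegion R).indicator fluxDensity)
      ((volume : Measure ℝ).prod volume) :=
    (measurable_fluxDensity.indicator (measurableSet_crossingRegion R)).aestronglyMeasurable
  rw [Measure.volume_eq_prod, integrable_prod_iff hm]
  refine ⟨Eventually.of_forall fun y => integrable_crossingRegion_slice R y, ?_⟩
  simp only [norm_of_nonneg (fluxDensity_indicator_nonneg R _)]
  rw [integral_crossingRegion_slice, integrable_indicator_iff measurableSet_Ioo]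
  exact ((integrableOn_arcsine_density R).mono_set Ioo_subset_Ioc_self).const_mul _

lemma integrableOn_fluxDensity (R : ℝ) :
    IntegrableOn fluxDensity (crossingRegion R) :=
  (integrable_indicator_iff (measurableSet_crossingRegion R)).1 (integrable_crossingRegion R)

lemma setIntegral_fluxDensity {R : ℝ} (hR : 0 < R) :
    ∫ p in crossingRegion R, fluxDensity p = 2 * π := by
  have h := integrable_crossingRegion R
  rw [← integral_indicator (measurableSet_crossingRegion R)]
  rw [Measure.volume_eq_prod] at h ⊢
  rw [integral_prod _ h, integral_crossingRegion_slice, integral_indicator measurableSet_Ioo,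
    integral_const_mul, integral_arcsine_density hR]

lemma ae_fst_ne (R : ℝ) : ∀ᵐ p : ℝ × ℝ, p.1 ≠ R :=
  Measure.quasiMeasurePreserving_fst.ae (Measure.ae_ne volume R)

lemma ae_snd_ne (R : ℝ) : ∀ᵐ p : ℝ × ℝ, p.2 ≠ R :=
  Measure.quasiMeasurePreserving_snd.ae (Measure.ae_ne volume R)

lemma D1minus_ae_eq (R : ℝ) :
    D1minus R =ᵐ[volume] (crossingRegion R ∩ {p | p.2 ≤ R} : Set (ℝ × ℝ)) := by
  filter_upwards [ae_fst_ne R] with p hp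
  refine propext ⟨?_, ?_⟩
  · rintro ⟨h1, h2, h3, h4, h5⟩
    exact ⟨⟨h1, lt_of_le_of_ne h2 hp, h5⟩, h4⟩
  · rintro ⟨⟨h1, h2, h3⟩, h4⟩
    exact ⟨h1, h2.le, by linarith, h4, h3⟩

lemma D2minus_ae_eq (R : ℝ) :
    D2minus R =ᵐ[volume] (crossingRegion R \ {p | p.2 ≤ R} : Set (ℝ × ℝ)) := by
  filter_upwards [ae_fst_ne R, ae_snd_ne R] with p hp hp'
  refine propext ⟨?_, ?_⟩
  · rintro ⟨h1, h2, h3⟩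
    exact ⟨⟨h1, lt_of_le_of_ne h2 hp, by linarith⟩, not_le.2 (lt_of_le_of_ne h3 hp'.symm)⟩
  · rintro ⟨⟨h1, h2, h3⟩, h4⟩
    exact ⟨h1, h2.le, (not_le.1 h4).le⟩

lemma measurableSet_snd_le (R : ℝ) : MeasurableSet {p : ℝ × ℝ | p.2 ≤ R} :=
  measurableSet_le measurable_snd measurable_const

lemma measurableSet_D1minus (R : ℝ) : MeasurableSet (D1minus R) :=
  (measurableSet_lt measurable_const measurable_fst).inter
    ((measurableSet_le measurable_fst measurable_const).inter
      ((measurableSet_lt measurable_const measurable_snd).inter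
        ((measurableSet_le measurable_snd measurable_const).inter
          (measurableSet_le measurable_const (measurable_fst.add measurable_snd)))))

lemma measurableSet_D2minus (R : ℝ) : MeasurableSet (D2minus R) :=
  (measurableSet_lt measurable_const measurable_fst).inter
    ((measurableSet_le measurable_fst measurable_const).inter
      (measurableSet_le measurable_const measurable_snd))

lemma integrableOn_fluxDensity_D1minus (R : ℝ) :
    IntegrableOn fluxDensity (D1minus R) :=
  ((integrableOn_fluxDensity R).mono_set inter_subset_left).congr_set_ae (D1minus_ae_eq R)

lemma integrableOn_fluxDensity_D2minus (R : ℝ) :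
    IntegrableOn fluxDensity (D2minus R) :=
  ((integrableOn_fluxDensity R).mono_set sdiff_subset).congr_set_ae (D2minus_ae_eq R)

lemma setIntegral_D1minus_add_D2minus {R : ℝ} (hR : 0 < R) :
    (∫ p in D1minus R, fluxDensity p) + ∫ p in D2minus R, fluxDensity p = 2 * π := by
  rw [setIntegral_congr_set (D1minus_ae_eq R), setIntegral_congr_set (D2minus_ae_eq R),
    integral_inter_add_sdiff (measurableSet_snd_le R) (integrableOn_fluxDensity R),
    setIntegral_fluxDensity hR]

lemma swap_preimage_D1minus (R : ℝ) : Prod.swap ⁻¹' D1minus R = D1minus R := by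
  ext p
  simp only [D1minus, mem_preimage, mem_ofPred_eq, Prod.fst_swap, Prod.snd_swap]
  rw [add_comm p.2]
  tauto

lemma measurePreserving_swap_restrict_D1minus (R : ℝ) :
    MeasurePreserving (Prod.swap : ℝ × ℝ → ℝ × ℝ) (volume.restrict (D1minus R))
      (volume.restrict (D1minus R)) := by
  have h := (Measure.measurePreserving_swap (μ := (volume : Measure ℝ))
    (ν := (volume : Measure ℝ))).restrict_preimage (measurableSet_D1minus R)
  rwa [swap_preimage_D1minus] at h

lemma integrableOn_fluxDensity_swap (R : ℝ) :
    IntegrableOn (fun p => fluxDensity p.swap) (D1minus R) :=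
  (measurePreserving_swap_restrict_D1minus R).integrable_comp_of_integrable
    (integrableOn_fluxDensity_D1minus R)

lemma setIntegral_fluxDensity_swap (R : ℝ) :
    ∫ p in D1minus R, fluxDensity p.swap = ∫ p in D1minus R, fluxDensity p :=
  (measurePreserving_swap_restrict_D1minus R).integral_comp
    MeasurableEquiv.prodComm.measurableEmbedding _

lemma powerLaw_mul_kernel_mul_fst (lam A : ℝ) {y z : ℝ} (hy : 0 < y) (hz : 0 < z) :
    (A * y ^ (-(3 + lam)/2)) * (A * z ^ (-(3 + lam)/2)) * (y * z) ^ (lam/2) * y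
      = A ^ 2 * fluxDensity (y, z) := by
  have e1 : y ^ (-(1/2) : ℝ) = y ^ (-(3 + lam)/2) * y ^ (lam/2) * y := by
    rw [← rpow_add hy, ← rpow_add_one hy.ne']
    congr 1
    ring
  have e2 : z ^ (-(3/2) : ℝ) = z ^ (-(3 + lam)/2) * z ^ (lam/2) := by
    rw [← rpow_add hz]
    congr 1
    ring
  rw [fluxDensity, mul_rpow hy.le hz.le, e1, e2]
  ring

lemma powerLaw_mul_kernel_mul_add (lam A : ℝ) {y z : ℝ} (hy : 0 < y) (hz : 0 < z) :
    (A * y ^ (-(3 + lam)/2)) * (A * z ^ (-(3 + lam)/2)) * (y * z) ^ (lam/2) * (y + z)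
      = A ^ 2 * (fluxDensity (y, z) + fluxDensity (z, y)) := by
  rw [mul_add (A ^ 2), ← powerLaw_mul_kernel_mul_fst lam A hy hz,
    ← powerLaw_mul_kernel_mul_fst lam A hz hy, mul_comm z y]
  ring

theorem flux_of_power_law_profile
    (lam : ℝ) (hlam1 : 1 < lam) (hlam2 : lam < 2) (A : ℝ) (hA : 0 < A) :
    (∀ R : ℝ, 0 < R →
      IntegrableOn (fun p : ℝ × ℝ =>
          (A * p.1 ^ (-(3 + lam)/2)) * (A * p.2 ^ (-(3 + lam)/2))
            * (p.1 * p.2) ^ (lam/2) * (p.1 + p.2)) (D1minus R) ∧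
      IntegrableOn (fun p : ℝ × ℝ =>
          (A * p.1 ^ (-(3 + lam)/2)) * (A * p.2 ^ (-(3 + lam)/2))
            * (p.1 * p.2) ^ (lam/2) * p.1) (D2minus R) ∧
      Jflux lam A R = 2 * π * A ^ 2) ∧
    Tendsto (fun R => Jflux lam A R) atTop (nhds (2 * π * A ^ 2)) := by
  have key : ∀ R : ℝ, 0 < R →
      IntegrableOn (fun p : ℝ × ℝ =>
          (A * p.1 ^ (-(3 + lam)/2)) * (A * p.2 ^ (-(3 + lam)/2))
            * (p.1 * p.2) ^ (lam/2) * (p.1 + p.2)) (D1minus R) ∧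
      IntegrableOn (fun p : ℝ × ℝ =>
          (A * p.1 ^ (-(3 + lam)/2)) * (A * p.2 ^ (-(3 + lam)/2))
            * (p.1 * p.2) ^ (lam/2) * p.1) (D2minus R) ∧
      Jflux lam A R = 2 * π * A ^ 2 := by
    intro R hR
    have e1 : EqOn (fun p : ℝ × ℝ =>
        (A * p.1 ^ (-(3 + lam)/2)) * (A * p.2 ^ (-(3 + lam)/2))
          * (p.1 * p.2) ^ (lam/2) * (p.1 + p.2))
        (fun p => A ^ 2 * (fluxDensity p + fluxDensity p.swap)) (D1minus R) :=
      fun p hp => powerLaw_mul_kernel_mul_add lam A hp.1 hp.2.2.1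
    have e2 : EqOn (fun p : ℝ × ℝ =>
        (A * p.1 ^ (-(3 + lam)/2)) * (A * p.2 ^ (-(3 + lam)/2))
          * (p.1 * p.2) ^ (lam/2) * p.1)
        (fun p => A ^ 2 * fluxDensity p) (D2minus R) :=
      fun p hp => powerLaw_mul_kernel_mul_fst lam A hp.1 (hR.trans_le hp.2.2)
    have i1 := integrableOn_fluxDensity_D1minus R
    have i1' := integrableOn_fluxDensity_swap R
    have i2 := integrableOn_fluxDensity_D2minus R
    refine ⟨?_, ?_, ?_⟩
    · rw [integrableOn_congr_fun e1 (measurableSet_D1minus R)]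
      exact (i1.add i1').const_mul _
    · rw [integrableOn_congr_fun e2 (measurableSet_D2minus R)]
      exact i2.const_mul _
    · rw [Jflux, setIntegral_congr_fun (measurableSet_D1minus R) e1,
        setIntegral_congr_fun (measurableSet_D2minus R) e2, integral_const_mul,
        integral_const_mul, integral_add i1 i1', setIntegral_fluxDensity_swap]
      linear_combination A ^ 2 * setIntegral_D1minus_add_D2minus hR
  refine ⟨key, tendsto_const_nhds.congr' ?_⟩
  filter_upwards [eventually_gt_atTop 0] with R hR
  exact (key R hR).2.2.symm
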